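/- Let G and H be finite connected simple graphs, each of minimum degree at least 3, and let f be an isomorphism from G3 to H3. Then f maps the vertex class V(G) onto V(H), the class V1(G) = E(G) onto V1(H) = E(H), and the class V2(G) (the incidences of G) onto V2(H) (the incidences of H). -/

import Mathlib

open SimpleGraph
open scoped Classical

/-- The incidences of a graph `G`: pairs `(v, e)` where `e ∈ E(G)` and `v` is an
endpoint of `e`. This is the set `V2` of the construction. -/
abbrev SimpleGraph.Incidences {V : Type*} (G : SimpleGraph V) : Type _ :=
  {p : V × G.edgeSet // p.1 ∈ (p.2 : Sym2 V)}

/-- `G2`: the graph obtained from `G` by subdividing every edge twice.  Its vertex set is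
`V ⊕ V1 ⊕ V2` (with `V1 = E(G)` and `V2` the incidences of `G`), and its edges are exactly
`{v, (v,e)}` and `{e, (v,e)}` for every incidence `(v,e)`. -/
def SimpleGraph.subdivTwice {V : Type*} (G : SimpleGraph V) :
    SimpleGraph (V ⊕ (G.edgeSet ⊕ G.Incidences)) :=
  SimpleGraph.fromRel fun x y =>
    match x, y with
    | Sum.inl v, Sum.inr (Sum.inr i) => i.val.1 = v
    | Sum.inr (Sum.inl e), Sum.inr (Sum.inr i) => i.val.2 = e
    | _, _ => False

/-- `G3`: the graph obtained from `G2` by adding all edges `{v, e}` with `v ∈ V`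
and `e ∈ V1 = E(G)`. -/
def SimpleGraph.gThree {V : Type*} (G : SimpleGraph V) :
    SimpleGraph (V ⊕ (G.edgeSet ⊕ G.Incidences)) :=
  G.subdivTwice ⊔ (SimpleGraph.fromRel fun x y =>
    match x, y with
    | Sum.inl _, Sum.inr (Sum.inl _) => True
    | _, _ => False)

/-- `G'`: the complement of `G3`. -/
def SimpleGraph.gPrime {V : Type*} (G : SimpleGraph V) :
    SimpleGraph (V ⊕ (G.edgeSet ⊕ G.Incidences)) :=
  (G.gThree)ᶜ

/-- A circular arc in `ZMod n`: a set of the form `{a, a+1, …, a+k}`. -/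
def IsCircularArc {n : ℕ} (A : Set (ZMod n)) : Prop :=
  ∃ (a : ZMod n) (k : ℕ), A = {x | ∃ j : ℕ, j ≤ k ∧ x = a + (j : ZMod n)}

/-- A proper circular-arc representation of `G` on `ZMod n`: every vertex gets a circular
arc, distinct vertices are adjacent iff their arcs intersect, and no arc of a vertex is a
strict subset of the arc of another vertex. -/
def IsProperCircularArcRep {W : Type*} (G : SimpleGraph W) {n : ℕ}
    (f : W → Set (ZMod n)) : Prop :=
  (∀ v, IsCircularArc (f v)) ∧
  (∀ u w, u ≠ w → (G.Adj u w ↔ (f u ∩ f w).Nonempty)) ∧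
  (∀ u w, u ≠ w → ¬ (f u ⊂ f w))

/-- `G` is a proper circular-arc graph if it admits a proper circular-arc
representation on some `ZMod n` with `n ≥ 1`. -/
def IsProperCircularArcGraph {W : Type*} (G : SimpleGraph W) : Prop :=
  ∃ n : ℕ, 1 ≤ n ∧ ∃ f : W → Set (ZMod n), IsProperCircularArcRep G f

/-- `G` is a disjoint union of stars: every vertex has degree at least `1` and every edge
has an endpoint of degree `1`. -/
def IsDisjointUnionOfStars {W : Type*} [Fintype W] (G : SimpleGraph W) : Prop :=
  (∀ v, 1 ≤ G.degree v) ∧ (∀ u w, G.Adj u w → G.degree u = 1 ∨ G.degree w = 1)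

/-- `B(n,m)`: the graph on `{c} ⊕ Fin n ⊕ Fin m` where `c, x_0, …, x_{n-1}` form a cycle of
length `n+1` and `c, y_0, …, y_{m-1}` form a cycle of length `m+1`; for `n, m ≥ 2` these are
exactly the subdivisions of the graph `B` of two triangles sharing a vertex. -/
def BGraph (n m : ℕ) : SimpleGraph (Unit ⊕ (Fin n ⊕ Fin m)) :=
  SimpleGraph.fromRel fun a b =>
    match a, b with
    | Sum.inl _, Sum.inr (Sum.inl x) => x.val = 0 ∨ x.val = n - 1
    | Sum.inl _, Sum.inr (Sum.inr y) => y.val = 0 ∨ y.val = m - 1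
    | Sum.inr (Sum.inl x), Sum.inr (Sum.inl x') => x'.val = x.val + 1
    | Sum.inr (Sum.inr y), Sum.inr (Sum.inr y') => y'.val = y.val + 1
    | _, _ => False

/-- `H` is a proper `B`-graph: there is a subdivision `B(n,m)` of `B` and an assignment of
nonempty connected subsets of `B(n,m)` to the vertices of `H` such that distinct vertices are
adjacent iff their subsets intersect, and no subset is a strict subset of another. -/
def IsProperBGraph {W : Type*} (H : SimpleGraph W) : Prop :=
  ∃ n m : ℕ, 2 ≤ n ∧ 2 ≤ m ∧
    ∃ f : W → Set (Unit ⊕ (Fin n ⊕ Fin m)),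
      (∀ v, (f v).Nonempty) ∧
      (∀ v, ((BGraph n m).induce (f v)).Connected) ∧
      (∀ u w, u ≠ w → (H.Adj u w ↔ (f u ∩ f w).Nonempty)) ∧
      (∀ u w, u ≠ w → ¬ (f u ⊂ f w))

namespace SimpleGraph

/-- The vertex `x` has at most two neighbours. -/
def AtMostTwoNeighbors {X : Type*} (K : SimpleGraph X) (x : X) : Prop :=
  ∀ a b c, K.Adj x a → K.Adj x b → K.Adj x c → a = b ∨ a = c ∨ b = c

/-- The vertex `x` has three distinct neighbours, each with at most two neighbours. -/
def HasThreeThinNeighbors {X : Type*} (K : SimpleGraph X) (x : X) : Prop :=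
  ∃ a b c, a ≠ b ∧ a ≠ c ∧ b ≠ c ∧ K.Adj x a ∧ K.Adj x b ∧ K.Adj x c ∧
    K.AtMostTwoNeighbors a ∧ K.AtMostTwoNeighbors b ∧ K.AtMostTwoNeighbors c

section Iso

variable {X Y : Type*} {K : SimpleGraph X} {L : SimpleGraph Y}

theorem AtMostTwoNeighbors.map (f : K ≃g L) {x : X} (h : K.AtMostTwoNeighbors x) :
    L.AtMostTwoNeighbors (f x) := by
  intro a b c ha hb hc
  obtain ⟨a, rfl⟩ := f.surjective a
  obtain ⟨b, rfl⟩ := f.surjective b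
  obtain ⟨c, rfl⟩ := f.surjective c
  simpa using h a b c (f.map_adj_iff.1 ha) (f.map_adj_iff.1 hb) (f.map_adj_iff.1 hc)

theorem HasThreeThinNeighbors.map (f : K ≃g L) {x : X} (h : K.HasThreeThinNeighbors x) :
    L.HasThreeThinNeighbors (f x) := by
  obtain ⟨a, b, c, hab, hac, hbc, ha, hb, hc, ta, tb, tc⟩ := h
  exact ⟨f a, f b, f c, f.injective.ne hab, f.injective.ne hac, f.injective.ne hbc,
    f.map_adj_iff.2 ha, f.map_adj_iff.2 hb, f.map_adj_iff.2 hc, ta.map f, tb.map f, tc.map f⟩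

theorem atMostTwoNeighbors_map_iff (f : K ≃g L) {x : X} :
    L.AtMostTwoNeighbors (f x) ↔ K.AtMostTwoNeighbors x :=
  ⟨fun h => by simpa using h.map f.symm, fun h => h.map f⟩

theorem hasThreeThinNeighbors_map_iff (f : K ≃g L) {x : X} :
    L.HasThreeThinNeighbors (f x) ↔ K.HasThreeThinNeighbors x :=
  ⟨fun h => by simpa using h.map f.symm, fun h => h.map f⟩

end Iso

section GThree

variable {V : Type*} {G : SimpleGraph V}

theorem gThree_adj_inl_inl {v w : V} : ¬ G.gThree.Adj (Sum.inl v) (Sum.inl w) := by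
  simp [gThree, subdivTwice]

theorem gThree_adj_inl_edge {v : V} {e : G.edgeSet} :
    G.gThree.Adj (Sum.inl v) (Sum.inr (Sum.inl e)) := by
  simp [gThree, subdivTwice]

theorem gThree_adj_inl_incidence {v : V} {i : G.Incidences} :
    G.gThree.Adj (Sum.inl v) (Sum.inr (Sum.inr i)) ↔ i.val.1 = v := by
  simp [gThree, subdivTwice]

theorem gThree_adj_edge_edge {d e : G.edgeSet} :
    ¬ G.gThree.Adj (Sum.inr (Sum.inl d)) (Sum.inr (Sum.inl e)) := by
  simp [gThree, subdivTwice]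

theorem gThree_adj_edge_incidence {e : G.edgeSet} {i : G.Incidences} :
    G.gThree.Adj (Sum.inr (Sum.inl e)) (Sum.inr (Sum.inr i)) ↔ i.val.2 = e := by
  simp [gThree, subdivTwice]

theorem gThree_adj_incidence_incidence {i j : G.Incidences} :
    ¬ G.gThree.Adj (Sum.inr (Sum.inr i)) (Sum.inr (Sum.inr j)) := by
  simp [gThree, subdivTwice]

theorem gThree_incidence_adj {i : G.Incidences} {x : V ⊕ (G.edgeSet ⊕ G.Incidences)}
    (h : G.gThree.Adj (Sum.inr (Sum.inr i)) x) :
    x = Sum.inl i.val.1 ∨ x = Sum.inr (Sum.inl i.val.2) := by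
  rcases x with v | e | j
  · exact Or.inl (congrArg _ (gThree_adj_inl_incidence.1 h.symm).symm)
  · exact Or.inr (congrArg _ (congrArg _ (gThree_adj_edge_incidence.1 h.symm).symm))
  · exact (gThree_adj_incidence_incidence h).elim

theorem atMostTwoNeighbors_incidence (i : G.Incidences) :
    G.gThree.AtMostTwoNeighbors (Sum.inr (Sum.inr i)) := by
  intro a b c ha hb hc
  have ha := gThree_incidence_adj ha
  have hb := gThree_incidence_adj hb
  have hc := gThree_incidence_adj hc
  grind

variable [Fintype V]

theorem exists_three_adj {v : V} (h : 3 ≤ G.degree v) :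
    ∃ a b c, a ≠ b ∧ a ≠ c ∧ b ≠ c ∧ G.Adj v a ∧ G.Adj v b ∧ G.Adj v c := by
  obtain ⟨a, b, c, ha, hb, hc, hab, hac, hbc⟩ := Finset.two_lt_card_iff.1 h
  simp only [mem_neighborFinset] at ha hb hc
  exact ⟨a, b, c, hab, hac, hbc, ha, hb, hc⟩

theorem hasThreeThinNeighbors_inl {v : V} (h : 3 ≤ G.degree v) :
    G.gThree.HasThreeThinNeighbors (Sum.inl v) := by
  obtain ⟨a, b, c, hab, hac, hbc, ha, hb, hc⟩ := exists_three_adj h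
  let inc (w : V) (hw : G.Adj v w) : G.Incidences := ⟨(v, ⟨s(v, w), hw⟩), Sym2.mem_mk_left v w⟩
  have inc_ne {x y : V} (hx : G.Adj v x) (hy : G.Adj v y) (hxy : x ≠ y) :
      (Sum.inr (Sum.inr (inc x hx)) : V ⊕ (G.edgeSet ⊕ G.Incidences)) ≠
        Sum.inr (Sum.inr (inc y hy)) := by
    simp only [inc, ne_eq, Sum.inr.injEq, Subtype.mk.injEq, Prod.mk.injEq, true_and]
    exact fun h => hxy (Sym2.congr_right.1 (congrArg Subtype.val h))
  exact ⟨_, _, _, inc_ne ha hb hab, inc_ne ha hc hac, inc_ne hb hc hbc,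
    gThree_adj_inl_incidence.2 rfl, gThree_adj_inl_incidence.2 rfl,
    gThree_adj_inl_incidence.2 rfl, atMostTwoNeighbors_incidence _,
    atMostTwoNeighbors_incidence _, atMostTwoNeighbors_incidence _⟩

theorem atMostTwoNeighbors_gThree_iff (hG : ∀ v, 3 ≤ G.degree v)
    (x : V ⊕ (G.edgeSet ⊕ G.Incidences)) :
    G.gThree.AtMostTwoNeighbors x ↔
      x ∈ Set.range (fun i : G.Incidences =>
        (Sum.inr (Sum.inr i) : V ⊕ (G.edgeSet ⊕ G.Incidences))) := by
  rcases x with v | e | i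
  · refine iff_of_false (fun h => ?_) (by simp)
    obtain ⟨a, b, c, hab, hac, hbc, ha, hb, hc, -⟩ := hasThreeThinNeighbors_inl (hG v)
    grind [h a b c ha hb hc]
  · refine iff_of_false (fun h => ?_) (by simp)
    obtain ⟨a, b, c, hab, hac, hbc, -⟩ := exists_three_adj (hG (e : Sym2 V).out.1)
    have := h (Sum.inl a) (Sum.inl b) (Sum.inl c) gThree_adj_inl_edge.symm
      gThree_adj_inl_edge.symm gThree_adj_inl_edge.symm
    simp_all
  · exact iff_of_true (atMostTwoNeighbors_incidence i) ⟨i, rfl⟩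

theorem hasThreeThinNeighbors_gThree_iff (hG : ∀ v, 3 ≤ G.degree v)
    (x : V ⊕ (G.edgeSet ⊕ G.Incidences)) :
    G.gThree.HasThreeThinNeighbors x ↔
      x ∈ Set.range (Sum.inl : V → V ⊕ (G.edgeSet ⊕ G.Incidences)) := by
  rcases x with v | e | i
  · exact iff_of_true (hasThreeThinNeighbors_inl (hG v)) ⟨v, rfl⟩
  · refine iff_of_false ?_ (by simp)
    rintro ⟨a, b, c, hab, hac, hbc, ha, hb, hc, ta, tb, tc⟩
    obtain ⟨⟨⟨p, d⟩, hp⟩, rfl⟩ := (atMostTwoNeighbors_gThree_iff hG a).1 ta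
    obtain ⟨⟨⟨q, d'⟩, hq⟩, rfl⟩ := (atMostTwoNeighbors_gThree_iff hG b).1 tb
    obtain ⟨⟨⟨r, d''⟩, hr⟩, rfl⟩ := (atMostTwoNeighbors_gThree_iff hG c).1 tc
    obtain rfl := gThree_adj_edge_incidence.1 ha
    obtain rfl := gThree_adj_edge_incidence.1 hb
    obtain rfl := gThree_adj_edge_incidence.1 hc
    obtain ⟨⟨u, w⟩, he⟩ := d''
    simp only [Sym2.mem_iff] at hp hq hr
    simp only [ne_eq, Sum.inr.injEq, Subtype.mk.injEq, Prod.mk.injEq, and_true] at hab hac hbc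
    grind
  · refine iff_of_false ?_ (by simp)
    rintro ⟨a, b, c, hab, hac, hbc, ha, hb, hc, -⟩
    grind [atMostTwoNeighbors_incidence i a b c ha hb hc]

end GThree

end SimpleGraph

theorem Equiv.image_eq_of_forall_mem_iff {X Y : Type*} (f : X ≃ Y) {s : Set X} {t : Set Y}
    (h : ∀ x, f x ∈ t ↔ x ∈ s) : f '' s = t := by
  rw [show s = f ⁻¹' t from Set.ext fun x => (h x).symm, f.image_preimage]

/-- any isomorphism `G3 ≅ H3` maps each of the three vertex classes of `G3`
onto the corresponding vertex class of `H3`. -/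
theorem stmt4 {V W : Type*} [Fintype V] [Fintype W]
    (G : SimpleGraph V) (H : SimpleGraph W)
    (hGc : G.Connected) (hHc : H.Connected)
    (hGd : ∀ v, 3 ≤ G.degree v) (hHd : ∀ w, 3 ≤ H.degree w)
    (f : G.gThree ≃g H.gThree) :
    (⇑f '' Set.range (Sum.inl : V → V ⊕ (G.edgeSet ⊕ G.Incidences)) =
      Set.range (Sum.inl : W → W ⊕ (H.edgeSet ⊕ H.Incidences))) ∧
    (⇑f '' Set.range (fun e : G.edgeSet =>
        (Sum.inr (Sum.inl e) : V ⊕ (G.edgeSet ⊕ G.Incidences))) =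
      Set.range (fun e : H.edgeSet =>
        (Sum.inr (Sum.inl e) : W ⊕ (H.edgeSet ⊕ H.Incidences)))) ∧
    (⇑f '' Set.range (fun i : G.Incidences =>
        (Sum.inr (Sum.inr i) : V ⊕ (G.edgeSet ⊕ G.Incidences))) =
      Set.range (fun i : H.Incidences =>
        (Sum.inr (Sum.inr i) : W ⊕ (H.edgeSet ⊕ H.Incidences)))) := by
  have hV (x) : f x ∈ Set.range (Sum.inl : W → W ⊕ (H.edgeSet ⊕ H.Incidences)) ↔
      x ∈ Set.range (Sum.inl : V → V ⊕ (G.edgeSet ⊕ G.Incidences)) := by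
    rw [← hasThreeThinNeighbors_gThree_iff hHd, ← hasThreeThinNeighbors_gThree_iff hGd,
      hasThreeThinNeighbors_map_iff]
  have hI (x) : f x ∈ Set.range (fun i : H.Incidences =>
        (Sum.inr (Sum.inr i) : W ⊕ (H.edgeSet ⊕ H.Incidences))) ↔
      x ∈ Set.range (fun i : G.Incidences =>
        (Sum.inr (Sum.inr i) : V ⊕ (G.edgeSet ⊕ G.Incidences))) := by
    rw [← atMostTwoNeighbors_gThree_iff hHd, ← atMostTwoNeighbors_gThree_iff hGd,
      atMostTwoNeighbors_map_iff]
  refine ⟨f.toEquiv.image_eq_of_forall_mem_iff hV, f.toEquiv.image_eq_of_forall_mem_iff ?_,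
    f.toEquiv.image_eq_of_forall_mem_iff hI⟩
  intro x
  specialize hV x
  specialize hI x
  change f x ∈ _ ↔ _
  generalize f x = y at hV hI ⊢
  rcases x with v | e | i <;> rcases y with w | d | j <;> simp_all
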